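/- Let n ≥ 2. There is a constant C = C(n) > 0 such that for every f ∈ L²_{loc}(ℝⁿ) with ‖f‖_{L_{2,n−2}} < ∞ and every t > 0, ‖e^{tΔ}f‖_{L_{4,n−2}} ≤ C t^{−1/4} ‖f‖_{L_{2,n−2}}. -/

import Mathlib

open MeasureTheory Metric Real
open scoped ENNReal NNReal

noncomputable section

/-- The heat extension `e^{tΔ}f` of a function `f : ℝⁿ → ℂ`. -/
def heatExt (n : ℕ) (f : EuclideanSpace ℝ (Fin n) → ℂ) (t : ℝ)
    (x : EuclideanSpace ℝ (Fin n)) : ℂ :=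
  ∫ y, ((4 * π * t) ^ (-(n : ℝ) / 2) * Real.exp (-‖x - y‖ ^ 2 / (4 * t))) • f y

/-- The square Morrey norm `‖f‖_{L_{2,n−2}}`. -/
def MorreyNorm (n : ℕ) (f : EuclideanSpace ℝ (Fin n) → ℂ) : ℝ≥0∞ :=
  ⨆ (r : ℝ) (_ : 0 < r) (x : EuclideanSpace ℝ (Fin n)),
    (ENNReal.ofReal (r ^ ((2 : ℝ) - (n : ℝ))) *
      ∫⁻ y in Metric.ball x r, (‖f y‖₊ : ℝ≥0∞) ^ 2) ^ (1 / 2 : ℝ)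

/-- The `L_{4,n−2}` Morrey norm `‖g‖_{L_{4,n−2}}`. -/
def Morrey4Norm (n : ℕ) (g : EuclideanSpace ℝ (Fin n) → ℂ) : ℝ≥0∞ :=
  ⨆ (r : ℝ) (_ : 0 < r) (x : EuclideanSpace ℝ (Fin n)),
    (ENNReal.ofReal (r ^ ((2 : ℝ) - (n : ℝ))) *
      ∫⁻ y in Metric.ball x r, (‖g y‖₊ : ℝ≥0∞) ^ 4) ^ (1 / 4 : ℝ)

/-- The heat kernel on `ℝⁿ` at time `t`. -/
def heatKernel (n : ℕ) (t : ℝ) (z : EuclideanSpace ℝ (Fin n)) : ℝ :=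
  (4 * π * t) ^ (-(n : ℝ) / 2) * Real.exp (-‖z‖ ^ 2 / (4 * t))

theorem heatKernel_nonneg (n : ℕ) {t : ℝ} (ht : 0 < t) (z : EuclideanSpace ℝ (Fin n)) :
    0 ≤ heatKernel n t z := by
  unfold heatKernel
  positivity

theorem continuous_heatKernel (n : ℕ) (t : ℝ) : Continuous (heatKernel n t) := by
  unfold heatKernel
  fun_prop

theorem lintegral_heatKernel (n : ℕ) {t : ℝ} (ht : 0 < t) :
    ∫⁻ z, ENNReal.ofReal (heatKernel n t z) = 1 := by
  have h1 : ∫ z, heatKernel n t z = 1 := by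
    have h := GaussianFourier.integral_rexp_neg_mul_sq_norm (V := EuclideanSpace ℝ (Fin n))
      (b := 1 / (4 * t)) (by positivity)
    have h2 : ∀ z : EuclideanSpace ℝ (Fin n), -‖z‖ ^ 2 / (4 * t) = -(1 / (4 * t)) * ‖z‖ ^ 2 := by
      intro z; ring
    simp only [heatKernel, integral_const_mul, h2]
    rw [h, finrank_euclideanSpace_fin, show π / (1 / (4 * t)) = 4 * π * t by field_simp,
      ← Real.rpow_add (by positivity), neg_div, neg_add_cancel, Real.rpow_zero]
  rw [← ofReal_integral_eq_lintegral_ofReal, h1, ENNReal.ofReal_one]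
  · exact Integrable.of_integral_ne_zero (by rw [h1]; exact one_ne_zero)
  · exact ae_of_all _ (heatKernel_nonneg n ht)

/-- Cauchy–Schwarz with respect to the weight `k`. -/
theorem sq_lintegral_mul_le {α : Type*} [MeasurableSpace α] {μ : Measure α} {k g : α → ℝ≥0∞}
    (hk : Measurable k) (hg : Measurable g) :
    (∫⁻ y, k y * g y ∂μ) ^ 2 ≤ (∫⁻ y, k y ∂μ) * ∫⁻ y, k y * g y ^ 2 ∂μ := by
  have hs : ∀ a : ℝ≥0∞, (a ^ (1 / 2 : ℝ)) ^ 2 = a := fun a => by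
    rw [← ENNReal.rpow_natCast, ← ENNReal.rpow_mul]; norm_num
  have h := ENNReal.lintegral_mul_le_Lp_mul_Lq μ Real.HolderConjugate.two_two
    (f := fun y => k y ^ (1 / 2 : ℝ)) (g := fun y => k y ^ (1 / 2 : ℝ) * g y)
    (by fun_prop) (by fun_prop)
  simp only [Pi.mul_apply, ENNReal.rpow_two, mul_pow, hs, ← mul_assoc, ← sq] at h
  calc _ ≤ _ := pow_le_pow_left' h 2
    _ = _ := by rw [mul_pow, hs, hs]

theorem enorm_heatExt_sq_le {n : ℕ} {f : EuclideanSpace ℝ (Fin n) → ℂ} (hf : Measurable f)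
    {t : ℝ} (ht : 0 < t) (x : EuclideanSpace ℝ (Fin n)) :
    ‖heatExt n f t x‖ₑ ^ 2 ≤ ∫⁻ y, ENNReal.ofReal (heatKernel n t (x - y)) * ‖f y‖ₑ ^ 2 := by
  have hk : Measurable fun y => ENNReal.ofReal (heatKernel n t (x - y)) :=
    ((continuous_heatKernel n t).comp (continuous_const.sub continuous_id)).measurable.ennreal_ofReal
  have h1 : ‖heatExt n f t x‖ₑ ≤ ∫⁻ y, ENNReal.ofReal (heatKernel n t (x - y)) * ‖f y‖ₑ := by
    refine (enorm_integral_le_lintegral_enorm _).trans_eq (lintegral_congr fun y => ?_)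
    rw [enorm_smul]
    exact congrArg (· * ‖f y‖ₑ) (Real.enorm_of_nonneg (heatKernel_nonneg n ht (x - y)))
  refine (pow_le_pow_left' h1 2).trans ((sq_lintegral_mul_le hk hf.enorm).trans_eq ?_)
  rw [lintegral_sub_left_eq_self (fun z => ENNReal.ofReal (heatKernel n t z)) x,
    lintegral_heatKernel n ht, one_mul]

theorem setLIntegral_ball_le_morreyNorm {n : ℕ} (f : EuclideanSpace ℝ (Fin n) → ℂ) {r : ℝ}
    (hr : 0 < r) (x : EuclideanSpace ℝ (Fin n)) :
    ∫⁻ y in ball x r, ‖f y‖ₑ ^ 2 ≤ ENNReal.ofReal (r ^ ((n : ℝ) - 2)) * MorreyNorm n f ^ 2 := by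
  have h : (ENNReal.ofReal (r ^ ((2 : ℝ) - (n : ℝ))) * ∫⁻ y in ball x r, ‖f y‖ₑ ^ 2) ^ (1 / 2 : ℝ)
      ≤ MorreyNorm n f :=
    le_iSup_of_le r (le_iSup_of_le hr (le_iSup_of_le x le_rfl))
  have h2 := pow_le_pow_left' h 2
  rw [← ENNReal.rpow_natCast, ← ENNReal.rpow_mul] at h2
  norm_num at h2
  calc ∫⁻ y in ball x r, ‖f y‖ₑ ^ 2
      = ENNReal.ofReal (r ^ ((n : ℝ) - 2)) *
          (ENNReal.ofReal (r ^ ((2 : ℝ) - (n : ℝ))) * ∫⁻ y in ball x r, ‖f y‖ₑ ^ 2) := by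
        rw [← mul_assoc, ← ENNReal.ofReal_mul (by positivity), ← Real.rpow_add hr]
        simp
    _ ≤ _ := by gcongr

theorem setLIntegral_ball_heatKernel_le {n : ℕ} {f : EuclideanSpace ℝ (Fin n) → ℂ}
    (hf : Measurable f) {t : ℝ} (ht : 0 < t) {r : ℝ} (hr : 0 < r)
    (x : EuclideanSpace ℝ (Fin n)) :
    ∫⁻ w in ball x r, ∫⁻ y, ENNReal.ofReal (heatKernel n t (w - y)) * ‖f y‖ₑ ^ 2 ≤
      ENNReal.ofReal (r ^ ((n : ℝ) - 2)) * MorreyNorm n f ^ 2 := by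
  have hk : Measurable fun z => ENNReal.ofReal (heatKernel n t z) :=
    (continuous_heatKernel n t).measurable.ennreal_ofReal
  have hswap : ∀ w, ∫⁻ y, ENNReal.ofReal (heatKernel n t (w - y)) * ‖f y‖ₑ ^ 2 =
      ∫⁻ z, ENNReal.ofReal (heatKernel n t z) * ‖f (w - z)‖ₑ ^ 2 := fun w => by
    rw [← lintegral_sub_left_eq_self _ w]
    simp
  have hball : ∀ z, ∫⁻ w in ball x r, ‖f (w - z)‖ₑ ^ 2 ≤
      ENNReal.ofReal (r ^ ((n : ℝ) - 2)) * MorreyNorm n f ^ 2 := fun z => by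
    have h := (measurePreserving_sub_right volume z).setLIntegral_comp_preimage
      (measurableSet_ball (x := x - z) (ε := r)) (hf.enorm.pow_const 2)
    have hpre : (fun w => w - z) ⁻¹' ball (x - z) r = ball x r := by
      ext w; simp [dist_eq_norm]
    rw [hpre] at h
    exact h.trans_le (setLIntegral_ball_le_morreyNorm f hr _)
  simp only [hswap]
  rw [lintegral_lintegral_swap
    ((hk.comp measurable_snd).mul
      ((hf.comp (measurable_fst.sub measurable_snd)).enorm.pow_const 2)).aemeasurable]
  calc _ = ∫⁻ z, ENNReal.ofReal (heatKernel n t z) * ∫⁻ w in ball x r, ‖f (w - z)‖ₑ ^ 2 := by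
        refine lintegral_congr fun z => lintegral_const_mul _ ?_
        exact (hf.comp (measurable_id.sub_const z)).enorm.pow_const 2
    _ ≤ ∫⁻ z, ENNReal.ofReal (heatKernel n t z) *
          (ENNReal.ofReal (r ^ ((n : ℝ) - 2)) * MorreyNorm n f ^ 2) := by
        gcongr with z
        exact hball z
    _ = _ := by rw [lintegral_mul_const _ hk, lintegral_heatKernel n ht, one_mul]

theorem summable_exp_neg_mul_rpow (n : ℕ) :
    Summable fun k : ℕ => Real.exp (-k) * ((k : ℝ) + 1) ^ (((n : ℝ) - 2) / 2) := by
  have h := (summable_nat_add_iff 1).2 (Real.summable_pow_mul_exp_neg_nat_mul n one_pos)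
  refine Summable.of_nonneg_of_le (fun k => by positivity) (fun k => ?_)
    (h.mul_left (Real.exp 1))
  have h1 : ((k : ℝ) + 1) ^ (((n : ℝ) - 2) / 2) ≤ ((k : ℝ) + 1) ^ n := by
    rw [← Real.rpow_natCast]
    refine Real.rpow_le_rpow_of_exponent_le (by linarith [k.cast_nonneg (α := ℝ)]) ?_
    linarith [n.cast_nonneg (α := ℝ)]
  calc Real.exp (-k) * ((k : ℝ) + 1) ^ (((n : ℝ) - 2) / 2)
      ≤ Real.exp (-k) * ((k : ℝ) + 1) ^ n := by gcongr
    _ = Real.exp 1 * (((k + 1 : ℕ) : ℝ) ^ n * Real.exp (-1 * ((k + 1 : ℕ) : ℝ))) := by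
        rw [mul_left_comm, ← Real.exp_add, mul_comm]
        push_cast
        ring_nf

/-- The heat kernel is dominated by a superposition of indicators of balls. -/
theorem ofReal_heatKernel_le (n : ℕ) {t : ℝ} (ht : 0 < t) (x y : EuclideanSpace ℝ (Fin n)) :
    ENNReal.ofReal (heatKernel n t (x - y)) ≤
      ∑' k : ℕ, (ball x (√(4 * t * (k + 1)))).indicator
        (fun _ => ENNReal.ofReal ((4 * π * t) ^ (-(n : ℝ) / 2) * Real.exp (-k))) y := by
  set s := ‖x - y‖ ^ 2 / (4 * t) with hs
  have hs0 : 0 ≤ s := by positivity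
  refine le_trans ?_ (ENNReal.le_tsum ⌊s⌋₊)
  have hmem : y ∈ ball x (√(4 * t * ((⌊s⌋₊ : ℝ) + 1))) := by
    rw [mem_ball, dist_eq_norm, norm_sub_rev]
    apply Real.lt_sqrt_of_sq_lt
    have := Nat.lt_floor_add_one s
    rwa [hs, div_lt_iff₀' (by positivity)] at this
  rw [Set.indicator_of_mem hmem]
  apply ENNReal.ofReal_le_ofReal
  unfold heatKernel
  gcongr
  rw [neg_div]
  exact neg_le_neg (Nat.floor_le hs0)

theorem lintegral_heatKernel_mul_le {n : ℕ} {f : EuclideanSpace ℝ (Fin n) → ℂ}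
    (hf : Measurable f) {t : ℝ} (ht : 0 < t) (x : EuclideanSpace ℝ (Fin n)) :
    ∫⁻ y, ENNReal.ofReal (heatKernel n t (x - y)) * ‖f y‖ₑ ^ 2 ≤
      ENNReal.ofReal ((π ^ (-(n : ℝ) / 2) / 4 *
        ∑' k : ℕ, Real.exp (-k) * ((k : ℝ) + 1) ^ (((n : ℝ) - 2) / 2)) * t⁻¹) *
        MorreyNorm n f ^ 2 := by
  set c : ℕ → ℝ := fun k => (4 * π * t) ^ (-(n : ℝ) / 2) * Real.exp (-k) with hc
  have hscale : ∀ k : ℕ, c k * √(4 * t * (k + 1)) ^ ((n : ℝ) - 2) =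
      π ^ (-(n : ℝ) / 2) / 4 * t⁻¹ *
        (Real.exp (-k) * ((k : ℝ) + 1) ^ (((n : ℝ) - 2) / 2)) := fun k => by
    have h4t : (4 * t) ^ (-(n : ℝ) / 2) * (4 * t) ^ (((n : ℝ) - 2) / 2) = (4 * t)⁻¹ := by
      rw [← Real.rpow_add (by positivity), ← Real.rpow_neg_one]
      ring_nf
    rw [Real.sqrt_eq_rpow, ← Real.rpow_mul (by positivity),
      show (1 / 2 : ℝ) * ((n : ℝ) - 2) = ((n : ℝ) - 2) / 2 by ring,
      Real.mul_rpow (by positivity) (by positivity), hc]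
    simp only
    rw [show 4 * π * t = π * (4 * t) by ring, Real.mul_rpow (by positivity) (by positivity)]
    calc _ = π ^ (-(n : ℝ) / 2) * ((4 * t) ^ (-(n : ℝ) / 2) * (4 * t) ^ (((n : ℝ) - 2) / 2)) *
          (Real.exp (-k) * ((k : ℝ) + 1) ^ (((n : ℝ) - 2) / 2)) := by ring
      _ = _ := by rw [h4t, mul_inv]; ring
  calc _ ≤ ∫⁻ y, ∑' k : ℕ, (ball x (√(4 * t * (k + 1)))).indicator
        (fun y => ENNReal.ofReal (c k) * ‖f y‖ₑ ^ 2) y := by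
        refine lintegral_mono fun y => ?_
        refine (mul_le_mul_left (ofReal_heatKernel_le n ht x y) _).trans_eq ?_
        rw [← ENNReal.tsum_mul_right]
        exact tsum_congr fun k => (Set.indicator_mul_left _ _ fun y => ‖f y‖ₑ ^ 2).symm
    _ = ∑' k : ℕ, ENNReal.ofReal (c k) *
          ∫⁻ y in ball x (√(4 * t * (k + 1))), ‖f y‖ₑ ^ 2 := by
        rw [lintegral_tsum fun k => (((hf.enorm.pow_const 2).const_mul _).indicator
          measurableSet_ball).aemeasurable]
        refine tsum_congr fun k => ?_
        rw [lintegral_indicator measurableSet_ball, lintegral_const_mul _ (hf.enorm.pow_const 2)]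
    _ ≤ ∑' k : ℕ, ENNReal.ofReal (π ^ (-(n : ℝ) / 2) / 4 * t⁻¹ *
          (Real.exp (-k) * ((k : ℝ) + 1) ^ (((n : ℝ) - 2) / 2))) * MorreyNorm n f ^ 2 := by
        refine ENNReal.tsum_le_tsum fun k => ?_
        rw [← hscale, ENNReal.ofReal_mul (p := c k) (by positivity),
          mul_assoc (ENNReal.ofReal (c k))]
        gcongr
        exact setLIntegral_ball_le_morreyNorm f (by positivity) x
    _ = _ := by
        rw [ENNReal.tsum_mul_right, ← ENNReal.ofReal_tsum_of_nonneg (fun k => by positivity)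
          ((summable_exp_neg_mul_rpow n).mul_left _), tsum_mul_left]
        ring_nf

/-- `‖e^{tΔ}f‖_{L_{4,n−2}} ≤ C t^{−1/4} ‖f‖_{L_{2,n−2}}` for `t > 0`. -/
theorem heat_ext_morrey4_bound (n : ℕ) (hn : 2 ≤ n) :
    ∃ C > (0 : ℝ), ∀ f : EuclideanSpace ℝ (Fin n) → ℂ,
      Measurable f → LocallyIntegrable (fun y => ‖f y‖ ^ 2) volume →
      MorreyNorm n f ≠ ⊤ → ∀ t > (0 : ℝ),
        Morrey4Norm n (heatExt n f t) ≤
          ENNReal.ofReal (C * t ^ (-(1 : ℝ) / 4)) * MorreyNorm n f := by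
  set A : ℝ := π ^ (-(n : ℝ) / 2) / 4 *
    ∑' k : ℕ, Real.exp (-k) * ((k : ℝ) + 1) ^ (((n : ℝ) - 2) / 2) with hA
  have hApos : 0 < A := by
    have := (summable_exp_neg_mul_rpow n).tsum_pos (fun k => by positivity) 0 (by positivity)
    positivity
  refine ⟨A ^ (1 / 4 : ℝ), by positivity, fun f hf _ _ t ht => ?_⟩
  refine iSup_le fun r => iSup_le fun hr => iSup_le fun x => ?_
  set M := MorreyNorm n f
  have hpt : ∀ w, ‖heatExt n f t w‖ₑ ^ 4 ≤ ENNReal.ofReal (A * t⁻¹) * M ^ 2 *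
      ∫⁻ y, ENNReal.ofReal (heatKernel n t (w - y)) * ‖f y‖ₑ ^ 2 := fun w => by
    have h := enorm_heatExt_sq_le hf ht w
    rw [show 4 = 2 + 2 from rfl, pow_add]
    exact mul_le_mul' (h.trans (lintegral_heatKernel_mul_le hf ht w)) h
  have hint : ENNReal.ofReal (r ^ ((2 : ℝ) - (n : ℝ))) *
      ∫⁻ w in ball x r, ‖heatExt n f t w‖ₑ ^ 4 ≤ ENNReal.ofReal (A * t⁻¹) * M ^ 4 := by
    have hmeas : Measurable fun w =>
        ∫⁻ y, ENNReal.ofReal (heatKernel n t (w - y)) * ‖f y‖ₑ ^ 2 := by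
      refine Measurable.lintegral_prod_right' (f := fun p : _ × _ =>
        ENNReal.ofReal (heatKernel n t (p.1 - p.2)) * ‖f p.2‖ₑ ^ 2) ?_
      exact ((continuous_heatKernel n t).measurable.comp
        (measurable_fst.sub measurable_snd)).ennreal_ofReal.mul
          ((hf.comp measurable_snd).enorm.pow_const 2)
    calc _ ≤ ENNReal.ofReal (r ^ ((2 : ℝ) - (n : ℝ))) * (ENNReal.ofReal (A * t⁻¹) * M ^ 2 *
          (ENNReal.ofReal (r ^ ((n : ℝ) - 2)) * M ^ 2)) := by
          gcongr
          refine (lintegral_mono hpt).trans ?_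
          rw [lintegral_const_mul _ hmeas]
          gcongr
          exact setLIntegral_ball_heatKernel_le hf ht hr x
      _ = ENNReal.ofReal (r ^ ((2 : ℝ) - (n : ℝ))) * ENNReal.ofReal (r ^ ((n : ℝ) - 2)) *
          (ENNReal.ofReal (A * t⁻¹) * M ^ 4) := by ring
      _ = _ := by
          rw [← ENNReal.ofReal_mul (by positivity), ← Real.rpow_add hr]
          simp
  refine (ENNReal.rpow_le_rpow hint (by norm_num)).trans_eq ?_
  rw [ENNReal.mul_rpow_of_nonneg _ _ (by norm_num),
    ENNReal.ofReal_rpow_of_nonneg (by positivity) (by norm_num),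
    Real.mul_rpow hApos.le (by positivity), ← ENNReal.rpow_natCast, ← ENNReal.rpow_mul,
    ← Real.rpow_neg_one, ← Real.rpow_mul ht.le]
  norm_num
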